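/- Let T > 0 and let b, b̃, σ, σ̃ belong to the class M with σ(x) > 0 and σ̃(x) > 0 for all x. Let u be a classical solution of the parabolic equation associated with (b, σ, f) and ũ a classical solution of the parabolic equation associated with (b̃, σ̃, f), where f(x) = x. Suppose there exist ε ∈ (0, T) and a nonempty open set ω ⊂ ℝ with u = ũ on (0, ε) × ω. Let x₀ ∈ ω and x₂ > x₀ be such that σ(x)² = σ̃(x)² for all x ∈ [x₀, x₂] and b − b̃ has a constant strict sign on (x₀, x₂] (i.e., b(x) − b̃(x) > 0 for all x ∈ (x₀, x₂] or b(x) − b̃(x) < 0 for all x ∈ (x₀, x₂]). Then a contradiction follows; that is, such x₀ and x₂ cannot exist. -/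

import Mathlib

open Set Filter

/-- A function `ψ : ℝ → ℝ` is piecewise analytic if there exist `δ > 0`, a strictly
increasing sequence `(κ j)_{j ∈ ℤ}` tending to `-∞` at `-∞` and `+∞` at `+∞` with
`κ (j+1) - κ j > δ`, and functions `φ j` analytic on `[κ j, κ (j+1)]`, such that
`ψ = φ j` on `[κ j, κ (j+1))`. -/
def PiecewiseAnalytic (ψ : ℝ → ℝ) : Prop :=
  ∃ (δ : ℝ) (κ : ℤ → ℝ) (φ : ℤ → ℝ → ℝ),
    0 < δ ∧ StrictMono κ ∧
    Tendsto κ atBot atBot ∧ Tendsto κ atTop atTop ∧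
    (∀ j : ℤ, δ < κ (j + 1) - κ j) ∧
    (∀ j : ℤ, AnalyticOn ℝ (φ j) (Icc (κ j) (κ (j + 1)))) ∧
    (∀ j : ℤ, ∀ x ∈ Ico (κ j) (κ (j + 1)), ψ x = φ j x)

/-- The class `M` of Lipschitz-continuous, piecewise analytic functions on `ℝ`. -/
def ClassM (ψ : ℝ → ℝ) : Prop :=
  (∃ K, LipschitzWith K ψ) ∧ PiecewiseAnalytic ψ

/-- `u : [0,T) × ℝ → ℝ` is a classical solution of
`∂ₜ u = (1/2) σ(x)² ∂ₓₓ u + b(x) ∂ₓ u`, `u(0, ·) = f`: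
`u`, `∂ₜ u`, `∂ₓ u`, `∂ₓₓ u` exist and are continuous on `[0,T) × ℝ`, the PDE holds
there, and the initial condition holds. -/
def IsClassicalSolution (T : ℝ) (b σ f : ℝ → ℝ) (u : ℝ → ℝ → ℝ) : Prop :=
  ContinuousOn (fun p : ℝ × ℝ => u p.1 p.2) (Ico 0 T ×ˢ univ) ∧
  (∀ t ∈ Ico 0 T, ∀ x : ℝ, DifferentiableAt ℝ (fun s => u s x) t) ∧
  (∀ t ∈ Ico 0 T, ∀ x : ℝ, DifferentiableAt ℝ (fun y => u t y) x) ∧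
  (∀ t ∈ Ico 0 T, ∀ x : ℝ, DifferentiableAt ℝ (deriv (fun y => u t y)) x) ∧
  ContinuousOn (fun p : ℝ × ℝ => deriv (fun s => u s p.2) p.1) (Ico 0 T ×ˢ univ) ∧
  ContinuousOn (fun p : ℝ × ℝ => deriv (fun y => u p.1 y) p.2) (Ico 0 T ×ˢ univ) ∧
  ContinuousOn (fun p : ℝ × ℝ => deriv (deriv (fun y => u p.1 y)) p.2) (Ico 0 T ×ˢ univ) ∧
  (∀ t ∈ Ico 0 T, ∀ x : ℝ,
    deriv (fun s => u s x) t =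
      (1 / 2) * (σ x) ^ 2 * deriv (deriv (fun y => u t y)) x
        + b x * deriv (fun y => u t y) x) ∧
  (∀ x : ℝ, u 0 x = f x)

/-- Case 1 in the proof of Theorem 3 is ruled out: on a region where the squared
diffusion coefficients coincide, the first-moment observation detects any
constant-strict-sign discrepancy of the drifts. -/
theorem case1_ruled_out
    (T : ℝ) (hT : 0 < T)
    (b bt sigma sigmat : ℝ → ℝ)
    (hb : ClassM b) (hbt : ClassM bt)
    (hs : ClassM sigma) (hst : ClassM sigmat)
    (hspos : ∀ x, 0 < sigma x) (hstpos : ∀ x, 0 < sigmat x)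
    (u ut : ℝ → ℝ → ℝ)
    (hu : IsClassicalSolution T b sigma (fun x => x) u)
    (hut : IsClassicalSolution T bt sigmat (fun x => x) ut)
    (ε : ℝ) (hε : ε ∈ Ioo 0 T)
    (ω : Set ℝ) (hω : IsOpen ω) (hωne : ω.Nonempty)
    (hobs : ∀ t ∈ Ioo 0 ε, ∀ x ∈ ω, u t x = ut t x)
    (x₀ x₂ : ℝ) (hx₀ : x₀ ∈ ω) (hx₂ : x₀ < x₂)
    (hσeq : ∀ x ∈ Icc x₀ x₂, (sigma x) ^ 2 = (sigmat x) ^ 2)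
    (hbsign : (∀ x ∈ Ioc x₀ x₂, 0 < b x - bt x) ∨
      (∀ x ∈ Ioc x₀ x₂, b x - bt x < 0)) :
    False := by
  -- a point of `ω` to the right of `x₀`
  obtain ⟨r, hr, hball⟩ := Metric.isOpen_iff.1 hω x₀ hx₀
  obtain ⟨x, hxω, hxI⟩ : ∃ x, x ∈ ω ∧ x ∈ Ioo x₀ x₂ := by
    have hm : 0 < min (r / 2) ((x₂ - x₀) / 2) := lt_min (by linarith) (by linarith)
    refine ⟨x₀ + min (r / 2) ((x₂ - x₀) / 2), hball ?_, by linarith, ?_⟩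
    · rw [Metric.mem_ball, Real.dist_eq, add_sub_cancel_left, abs_of_pos hm]
      linarith [min_le_left (r / 2) ((x₂ - x₀) / 2)]
    · linarith [min_le_right (r / 2) ((x₂ - x₀) / 2)]
  obtain ⟨-, -, -, -, -, -, -, hpde, -⟩ := hu
  obtain ⟨-, -, -, -, -, hcx, -, hpdet, hinit⟩ := hut
  have hbne : b x - bt x ≠ 0 := by
    rcases hbsign with h | h
    · exact (h x ⟨hxI.1, hxI.2.le⟩).ne'
    · exact (h x ⟨hxI.1, hxI.2.le⟩).ne
  -- the spatial derivative of `ut` vanishes at `x` for small positive times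
  have hzero : ∀ t ∈ Ioo 0 ε, deriv (fun y => ut t y) x = 0 := by
    intro t ht
    have htT : t ∈ Ico 0 T := ⟨ht.1.le, ht.2.trans hε.2⟩
    have h1 : deriv (fun s => u s x) t = deriv (fun s => ut s x) t := by
      apply Filter.EventuallyEq.deriv_eq
      filter_upwards [isOpen_Ioo.mem_nhds ht] with s hs'
      exact hobs s hs' x hxω
    have hev : (fun y => u t y) =ᶠ[nhds x] (fun y => ut t y) := by
      filter_upwards [hω.mem_nhds hxω] with y hy
      exact hobs t ht y hy
    have h2 := hev.deriv_eq
    have h3 := hev.deriv.deriv_eq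
    have e1 := hpde t htT x
    have e2 := hpdet t htT x
    have e3 := hσeq x ⟨hxI.1.le, hxI.2.le⟩
    rw [h1, h2, h3, e3, e2] at e1
    have : (b x - bt x) * deriv (fun y => ut t y) x = 0 := by linarith
    exact (mul_eq_zero.1 this).resolve_left hbne
  have h0 : deriv (fun y => ut 0 y) x = 1 := by
    have : (fun y => ut 0 y) = fun y => y := funext hinit
    rw [this]
    exact deriv_id x
  -- pass to the limit as the time tends to zero
  have hc : ContinuousWithinAt (fun t : ℝ => deriv (fun y => ut t y) x) (Ico 0 T) 0 := by
    have hc' : ContinuousOn (fun t : ℝ => deriv (fun y => ut t y) x) (Ico 0 T) :=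
      hcx.comp (f := fun t : ℝ => (t, x)) (by fun_prop) (fun t ht => ⟨ht, mem_univ _⟩)
    exact hc' 0 ⟨le_rfl, hT⟩
  have hlim : Tendsto (fun t : ℝ => deriv (fun y => ut t y) x) (nhdsWithin 0 (Ioo 0 ε))
      (nhds 1) := by
    have := (hc.mono (fun t ht => ⟨ht.1.le, ht.2.trans hε.2⟩ : Ioo 0 ε ⊆ Ico 0 T)).tendsto
    rwa [h0] at this
  have hlim0 : Tendsto (fun t : ℝ => deriv (fun y => ut t y) x) (nhdsWithin 0 (Ioo 0 ε))
      (nhds 0) := by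
    refine Tendsto.congr' ?_ tendsto_const_nhds
    filter_upwards [self_mem_nhdsWithin] with t ht
    exact (hzero t ht).symm
  haveI : (nhdsWithin (0 : ℝ) (Ioo 0 ε)).NeBot := left_nhdsWithin_Ioo_neBot hε.1
  exact one_ne_zero (tendsto_nhds_unique hlim hlim0)
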